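/- For every integer q ≥ 3 there exists a constant C > 0 (depending only on q) such that for all integers d ≥ 2 and n ≥ d+1 and every simple n-vertex d-regular graph G, the number of proper q-colorings of G satisfies c_q(G) ≤ η(q)^{n/2} · 2^{C·n·√((log d)/d)}. -/

import Mathlib

/-- The number of proper `q`-colorings of a graph `G`. -/
noncomputable def numColorings {V : Type*} (G : SimpleGraph V) (q : ℕ) : ℕ :=
  Nat.card {f : V → Fin q // ∀ v w, G.Adj v w → f v ≠ f w}

/-- `η(q) = ⌊q/2⌋ ⌈q/2⌉`, which is `q²/4` for even `q` and `(q²-1)/4` for odd `q`. -/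
def eta (q : ℕ) : ℕ := (q / 2) * ((q + 1) / 2)

open Finset

section Containers

variable {V : Type*} [Fintype V] [DecidableEq V] (G : SimpleGraph V) [DecidableRel G.Adj]

/-- The union of the neighborhoods of the vertices in `T`. -/
def nbhd (T : Finset V) : Finset V := T.biUnion fun v => G.neighborFinset v

/-- The vertices outside the neighborhood of `T` that have fewer than `φ` neighbors
outside the neighborhood of `T`. -/
noncomputable def container (φ : ℝ) (T : Finset V) : Finset V :=
  {v | v ∉ nbhd G T ∧ (#(G.neighborFinset v \ nbhd G T) : ℝ) < φ}

/-- Every independent set lies in the container of a small subset of itself. -/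
theorem exists_subset_container {φ : ℝ} (hφ : 0 < φ) (I : Finset V)
    (hI : ∀ v ∈ I, ∀ w ∈ I, ¬ G.Adj v w) :
    ∃ T : Finset V, (#T : ℝ) * φ ≤ Fintype.card V ∧ I ⊆ container G φ T := by
  obtain ⟨T, hT, hmax⟩ := Finset.exists_max_image
    (I.powerset.filter fun T => (#T : ℝ) * φ ≤ #(nbhd G T)) (fun T => #T)
    ⟨∅, by simp⟩
  simp only [mem_filter, mem_powerset] at hT hmax
  refine ⟨T, hT.2.trans (by exact_mod_cast card_le_univ _), fun v hv => ?_⟩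
  simp only [container, mem_filter, mem_univ, true_and]
  constructor
  · simp only [nbhd, mem_biUnion, SimpleGraph.mem_neighborFinset, not_exists, not_and]
    exact fun w hw => hI w (hT.1 hw) v hv
  · by_contra! h
    have hvT : v ∉ T := fun hvT => by
      have : G.neighborFinset v \ nbhd G T = ∅ :=
        sdiff_eq_empty_iff_subset.2 (subset_biUnion_of_mem (fun v => G.neighborFinset v) hvT)
      rw [this] at h
      simp at h
      linarith
    have hcard : #(nbhd G (insert v T)) = #(G.neighborFinset v \ nbhd G T) + #(nbhd G T) := by
      rw [card_sdiff_add_card, nbhd, biUnion_insert, nbhd]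
    have := hmax (insert v T) ⟨insert_subset hv hT.1, by
      rw [hcard, card_insert_of_notMem hvT]
      push_cast
      linarith [hT.2]⟩
    rw [card_insert_of_notMem hvT] at this
    omega

theorem card_neighbors_mem_container_le {φ : ℝ} {T : Finset V} {v : V}
    (hv : v ∈ container G φ T) :
    (#{w ∈ G.neighborFinset v | w ∈ container G φ T} : ℝ) ≤ φ := by
  simp only [container, mem_filter, mem_univ, true_and] at hv
  refine le_trans ?_ hv.2.le
  refine Nat.cast_le.2 (card_le_card fun w hw => ?_)
  simp only [container, mem_filter, mem_univ, true_and] at hw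
  exact mem_sdiff.2 ⟨hw.1, hw.2.1⟩

end Containers

theorem mul_le_eta {a b q : ℕ} (h : a + b ≤ q) : a * b ≤ eta q := by
  unfold eta
  obtain ⟨k, rfl | rfl⟩ := Nat.even_or_odd' q
  · rw [show 2 * k / 2 = k by omega, show (2 * k + 1) / 2 = k by omega]
    nlinarith [four_mul_le_sq_add a b]
  · rw [show (2 * k + 1) / 2 = k by omega, show (2 * k + 1 + 1) / 2 = k + 1 by omega]
    rcases le_or_gt a k with ha | ha
    · obtain ⟨c, rfl⟩ := Nat.exists_eq_add_of_le ha
      nlinarith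
    · have hb : b ≤ k := by omega
      obtain ⟨c, rfl⟩ := Nat.exists_eq_add_of_le hb
      nlinarith

theorem eta_pos {q : ℕ} (hq : 2 ≤ q) : 0 < eta q :=
  Nat.mul_pos (by omega) (by omega)

/-- If each vertex of a `d`-regular graph has a list of colors and each listed color is also
listed at no more than `φ` neighbors, then the number of choices from the lists is at most
`η(q) ^ (n / 2)` up to a factor `q ^ (q φ n / d)`. -/
theorem prod_card_lists_le {V : Type*} [Fintype V] [DecidableEq V] (G : SimpleGraph V)
    [DecidableRel G.Adj] {d q : ℕ} (hd : 0 < d) (hq : 2 ≤ q) (hG : G.IsRegularOfDegree d)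
    {φ : ℝ} (hφ : 0 ≤ φ) (L : V → Finset (Fin q))
    (hL : ∀ v, ∀ i ∈ L v, (#{w ∈ G.neighborFinset v | i ∈ L w} : ℝ) ≤ φ) :
    ∏ v, (#(L v) : ℝ) ≤ (eta q : ℝ) ^ ((Fintype.card V : ℝ) / 2) *
      (q : ℝ) ^ (q * φ * Fintype.card V / d) := by
  have hη : (0 : ℝ) < eta q := by exact_mod_cast eta_pos hq
  have hq0 : (0 : ℝ) < q := by exact_mod_cast (by omega : 0 < q)
  by_cases hempty : ∃ v, #(L v) = 0
  · obtain ⟨v, hv⟩ := hempty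
    rw [prod_eq_zero (mem_univ v) (by simp [hv])]
    positivity
  push Not at hempty
  have hpos : ∀ v, (0 : ℝ) < #(L v) := fun v => by
    exact_mod_cast Nat.pos_of_ne_zero (hempty v)
  have hlogq : 0 ≤ Real.log q := Real.log_natCast_nonneg q
  have hlogη : 0 ≤ Real.log (eta q) := Real.log_natCast_nonneg _
  have hle : ∀ v, Real.log #(L v) ≤ Real.log q := fun v =>
    Real.log_le_log (hpos v) (by exact_mod_cast (card_le_univ (L v)).trans (by simp))
  have hpair : ∀ v w, Real.log #(L v) + Real.log #(L w) ≤
      Real.log (eta q) + 2 * Real.log q * if Disjoint (L v) (L w) then 0 else 1 := by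
    intro v w
    split_ifs with h
    · rw [← Real.log_mul (hpos v).ne' (hpos w).ne', mul_zero, add_zero]
      refine Real.log_le_log (mul_pos (hpos v) (hpos w)) ?_
      have : #(L v) + #(L w) ≤ q := by
        rw [← card_union_of_disjoint h]
        exact (card_le_univ _).trans (by simp)
      exact_mod_cast mul_le_eta this
    · linarith [hle v, hle w]
  have hbad : ∀ v, (∑ w ∈ G.neighborFinset v, if Disjoint (L v) (L w) then (0 : ℝ) else 1) ≤
      q * φ := by
    intro v
    calc (∑ w ∈ G.neighborFinset v, if Disjoint (L v) (L w) then (0 : ℝ) else 1)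
        ≤ ∑ w ∈ G.neighborFinset v, ∑ i ∈ L v, if i ∈ L w then (1 : ℝ) else 0 := by
          refine sum_le_sum fun w _ => ?_
          split_ifs with h
          · exact sum_nonneg fun i _ => by split_ifs <;> norm_num
          · obtain ⟨i, hi, hi'⟩ := not_disjoint_iff.1 h
            refine le_trans ?_ (single_le_sum (f := fun i => if i ∈ L w then (1 : ℝ) else 0)
              (fun i _ => by split_ifs <;> norm_num) hi)
            simp [hi']
      _ = ∑ i ∈ L v, (#{w ∈ G.neighborFinset v | i ∈ L w} : ℝ) := by
          rw [sum_comm]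
          simp
      _ ≤ ∑ i ∈ L v, φ := sum_le_sum (hL v)
      _ = #(L v) * φ := by simp
      _ ≤ q * φ := by
          gcongr
          exact (card_le_univ (L v)).trans (by simp)
  have hcomm : ∑ v, ∑ w ∈ G.neighborFinset v, Real.log #(L w) =
      d * ∑ v, Real.log #(L v) := by
    rw [sum_comm' (t' := univ) (s' := fun w => G.neighborFinset w)
      (by simp [SimpleGraph.adj_comm]), mul_sum]
    exact sum_congr rfl fun v _ => by simp [hG.degree_eq v]
  have hdouble : 2 * d * ∑ v, Real.log #(L v) ≤
      Fintype.card V * (d * Real.log (eta q) + 2 * Real.log q * (q * φ)) := by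
    calc 2 * d * ∑ v, Real.log #(L v)
        = ∑ v, ∑ w ∈ G.neighborFinset v, (Real.log #(L v) + Real.log #(L w)) := by
          simp only [sum_add_distrib, hcomm]
          simp [hG.degree_eq, ← mul_sum]
          ring
      _ ≤ ∑ v, ∑ w ∈ G.neighborFinset v, (Real.log (eta q) +
            2 * Real.log q * if Disjoint (L v) (L w) then 0 else 1) :=
          sum_le_sum fun v _ => sum_le_sum fun w _ => hpair v w
      _ ≤ ∑ v : V, (d * Real.log (eta q) + 2 * Real.log q * (q * φ)) := by
          refine sum_le_sum fun v _ => ?_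
          rw [sum_add_distrib, ← mul_sum, sum_const, SimpleGraph.card_neighborFinset_eq_degree,
            hG.degree_eq v, nsmul_eq_mul]
          gcongr
          exact hbad v
      _ = _ := by rw [sum_const, card_univ, nsmul_eq_mul]
  have hd' : (0 : ℝ) < d := by exact_mod_cast hd
  rw [← Real.log_le_log_iff (prod_pos fun v _ => hpos v) (by positivity),
    Real.log_prod fun v _ => (hpos v).ne', Real.log_mul (by positivity) (by positivity),
    Real.log_rpow hη, Real.log_rpow hq0]
  have : (Fintype.card V : ℝ) / 2 * Real.log (eta q) + q * φ * Fintype.card V / d * Real.log q =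
      Fintype.card V * (d * Real.log (eta q) + 2 * Real.log q * (q * φ)) / (2 * d) := by
    field_simp
  rw [this, le_div_iff₀ (by positivity)]
  linarith

/-- A bound on the number of subsets of size at most `n / φ`. -/
theorem card_small_subsets_le (V : Type*) [Fintype V] {φ x : ℝ} (hφ : 0 < φ) (hx : 1 ≤ x) :
    (#{T : Finset V | (#T : ℝ) * φ ≤ Fintype.card V} : ℝ) ≤
      x ^ ((Fintype.card V : ℝ) / φ) * (1 + x⁻¹) ^ Fintype.card V := by
  have hx0 : 0 < x := by linarith
  calc (#{T : Finset V | (#T : ℝ) * φ ≤ Fintype.card V} : ℝ)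
      = ∑ T : Finset V with (#T : ℝ) * φ ≤ Fintype.card V, (1 : ℝ) := by simp
    _ ≤ ∑ T : Finset V with (#T : ℝ) * φ ≤ Fintype.card V,
          x ^ ((Fintype.card V : ℝ) / φ) * x⁻¹ ^ #T := by
        refine sum_le_sum fun T hT => ?_
        rw [inv_pow, ← Real.rpow_natCast, ← Real.rpow_neg hx0.le, ← Real.rpow_add hx0]
        refine Real.one_le_rpow hx ?_
        have := (le_div_iff₀ hφ).2 (mem_filter.1 hT).2
        linarith
    _ ≤ ∑ T : Finset V, x ^ ((Fintype.card V : ℝ) / φ) * x⁻¹ ^ #T :=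
        sum_le_sum_of_subset_of_nonneg (filter_subset _ _) fun T _ _ => by positivity
    _ = _ := by
        rw [← mul_sum, add_comm (1 : ℝ), ← Fintype.sum_pow_mul_eq_add_pow V x⁻¹ 1]
        simp

/-- The container bound on the number of colorings, with threshold `φ` and weight `x` free. -/
theorem numColorings_le {V : Type*} [Fintype V] [DecidableEq V] (G : SimpleGraph V)
    [DecidableRel G.Adj] {d q : ℕ} (hd : 0 < d) (hq : 2 ≤ q) (hG : G.IsRegularOfDegree d)
    {φ x : ℝ} (hφ : 0 < φ) (hx : 1 ≤ x) :
    (numColorings G q : ℝ) ≤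
      (x ^ ((Fintype.card V : ℝ) / φ) * (1 + x⁻¹) ^ Fintype.card V) ^ q *
        ((eta q : ℝ) ^ ((Fintype.card V : ℝ) / 2) *
          (q : ℝ) ^ (q * φ * Fintype.card V / d)) := by
  classical
  let S : Finset (Finset V) := {T | (#T : ℝ) * φ ≤ Fintype.card V}
  let L : (Fin q → Finset V) → V → Finset (Fin q) := fun T v => {i | v ∈ container G φ (T i)}
  have hsub : ({f : V → Fin q | ∀ v w, G.Adj v w → f v ≠ f w} : Finset (V → Fin q)) ⊆
      (Fintype.piFinset fun _ : Fin q => S).biUnion fun T => Fintype.piFinset (L T) := by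
    intro f hf
    simp only [mem_filter, mem_univ, true_and] at hf
    choose T hT hfT using fun i : Fin q => exists_subset_container G hφ {v | f v = i}
      (fun v hv w hw hvw => hf v w hvw (by simp_all))
    simp only [mem_biUnion, Fintype.mem_piFinset]
    exact ⟨T, fun i => by simpa [S] using hT i, fun v => by simpa [L] using hfT (f v) (by simp)⟩
  have hnum : numColorings G q =
      #({f : V → Fin q | ∀ v w, G.Adj v w → f v ≠ f w} : Finset (V → Fin q)) := by
    rw [numColorings, Nat.card_eq_fintype_card, Fintype.card_subtype]
  have hlist : ∀ T : Fin q → Finset V, (#(Fintype.piFinset (L T)) : ℝ) ≤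
      (eta q : ℝ) ^ ((Fintype.card V : ℝ) / 2) * (q : ℝ) ^ (q * φ * Fintype.card V / d) := by
    intro T
    rw [Fintype.card_piFinset]
    push_cast
    refine prod_card_lists_le G hd hq hG hφ.le (L T) fun v i hi => ?_
    simp only [L, mem_filter, mem_univ, true_and] at hi ⊢
    exact card_neighbors_mem_container_le G hi
  calc (numColorings G q : ℝ)
      ≤ ∑ T ∈ Fintype.piFinset fun _ : Fin q => S, (#(Fintype.piFinset (L T)) : ℝ) := by
        rw [hnum]
        exact_mod_cast (card_le_card hsub).trans card_biUnion_le
    _ ≤ (#S : ℝ) ^ q * ((eta q : ℝ) ^ ((Fintype.card V : ℝ) / 2) *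
          (q : ℝ) ^ (q * φ * Fintype.card V / d)) := by
        refine (sum_le_sum fun T _ => hlist T).trans_eq ?_
        simp
    _ ≤ _ := by
        gcongr
        exact card_small_subsets_le V hφ hx

theorem colorings_weak_upper_bound (q : ℕ) (hq : 3 ≤ q) :
    ∃ C : ℝ, 0 < C ∧
      ∀ (d n : ℕ), 2 ≤ d → d + 1 ≤ n →
        ∀ (G : SimpleGraph (Fin n)) [DecidableRel G.Adj],
          G.IsRegularOfDegree d →
          (numColorings G q : ℝ) ≤
            (eta q : ℝ) ^ ((n : ℝ) / 2) *
              (2 : ℝ) ^ (C * n * Real.sqrt (Real.logb 2 d / d)) := by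
  have hq0 : (0 : ℝ) < q := by exact_mod_cast (by omega : 0 < q)
  have hlog2 : 0 < Real.log 2 := Real.log_pos one_lt_two
  have hlogq : 0 ≤ Real.log q := Real.log_natCast_nonneg q
  refine ⟨q * (1 + (1 + Real.log q) / Real.log 2), by positivity, ?_⟩
  intro d n hd hn G _ hG
  have hd2 : (2 : ℝ) ≤ d := by exact_mod_cast hd
  have hd0 : (0 : ℝ) < d := by linarith
  have hlogd : 1 ≤ Real.logb 2 d := by
    rw [Real.le_logb_iff_rpow_le one_lt_two hd0]
    simpa using hd2
  set s := Real.sqrt (Real.logb 2 d / d)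
  have hs2 : s * s = Real.logb 2 d / d := Real.mul_self_sqrt (by positivity)
  have hs0 : 0 < s := Real.sqrt_pos.2 (by positivity)
  have hlogd_eq : Real.log d = d * (s * s) * Real.log 2 := by
    rw [hs2, Real.logb]
    field_simp
  have hinv : (d : ℝ)⁻¹ ≤ s := by
    refine Real.le_sqrt_of_sq_le ?_
    rw [sq, ← div_eq_mul_inv]
    gcongr
    exact (inv_le_one_of_one_le₀ (by linarith)).trans hlogd
  have hmain := numColorings_le G (q := q) (by omega : 0 < d) (by omega) hG
    (mul_pos hd0 hs0) (by linarith : (1 : ℝ) ≤ d)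
  rw [Fintype.card_fin] at hmain
  refine hmain.trans ?_
  have hη : (0 : ℝ) < eta q := by exact_mod_cast eta_pos (by omega)
  rw [mul_left_comm]
  gcongr
  rw [← Real.log_le_log_iff (by positivity) (by positivity),
    Real.log_mul (by positivity) (by positivity), Real.log_pow,
    Real.log_mul (by positivity) (by positivity), Real.log_pow, Real.log_rpow hd0,
    Real.log_rpow hq0, Real.log_rpow two_pos, hlogd_eq]
  have hlog1 : Real.log (1 + (d : ℝ)⁻¹) ≤ s :=
    (Real.log_le_sub_one_of_pos (by positivity)).trans (by linarith)
  calc (q : ℝ) * (n / (d * s) * (d * (s * s) * Real.log 2) + n * Real.log (1 + (d : ℝ)⁻¹)) +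
        q * (d * s) * n / d * Real.log q
      ≤ q * (n / (d * s) * (d * (s * s) * Real.log 2) + n * s) +
        q * (d * s) * n / d * Real.log q := by gcongr
    _ = q * (1 + (1 + Real.log q) / Real.log 2) * n * s * Real.log 2 := by
        field_simp
        ring
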